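/- If two subsets S₁ and S₂ of the customer set {1,…,n} are both optimal at a given unitary cost c ≥ 0, then S₁ ∪ S₂ and S₁ ∩ S₂ are also optimal at c. -/

import Mathlib

open Finset

/-- Expected revenue of a set of customers. -/
def R (pi p : ℕ → ℝ) (S : Finset ℕ) : ℝ := ∑ i ∈ S, pi i * p i

/-- Expected traveled distance (with l i = 2 * x i). -/
def L (x pi : ℕ → ℝ) (S : Finset ℕ) : ℝ :=
  ∑ i ∈ S, (2 * x i) * pi i * ∏ j ∈ S.filter (fun j => i < j), (1 - pi j)

/-- Expected profit at unitary cost c. -/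
def G (x pi p : ℕ → ℝ) (S : Finset ℕ) (c : ℝ) : ℝ := R pi p S - c * L x pi S

/-- Optimal value of the probabilistic profitable tour problem on a line. -/
def PPTP (n : ℕ) (x pi p : ℕ → ℝ) (c : ℝ) : ℝ :=
  (Finset.Icc 1 n).powerset.sup' (Finset.powerset_nonempty _) (fun S => G x pi p S c)

theorem L_insert_of_forall_lt (x pi : ℕ → ℝ) {a : ℕ} {S : Finset ℕ} (h : ∀ i ∈ S, i < a) :
    L x pi (insert a S) = 2 * x a * pi a + (1 - pi a) * L x pi S := by
  have ha : a ∉ S := fun h' => lt_irrefl _ (h a h')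
  have hempty : (insert a S).filter (fun j => a < j) = ∅ := by
    refine Finset.filter_eq_empty_iff.2 fun j hj => ?_
    rcases Finset.mem_insert.1 hj with rfl | hj
    · exact lt_irrefl _
    · exact (h j hj).not_gt
  unfold L
  rw [Finset.sum_insert ha, hempty, Finset.prod_empty, mul_one, Finset.mul_sum]
  congr 1
  refine Finset.sum_congr rfl fun i hi => ?_
  rw [Finset.filter_insert, if_pos (h i hi),
    Finset.prod_insert fun h' => ha (Finset.mem_of_mem_filter a h')]
  ring

theorem L_le_of_forall_le {x pi : ℕ → ℝ} {S : Finset ℕ} {M : ℝ} (hM : 0 ≤ M)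
    (hx : ∀ i ∈ S, x i ≤ M) (hpi : ∀ i ∈ S, 0 ≤ pi i ∧ pi i ≤ 1) : L x pi S ≤ 2 * M := by
  induction S using Finset.induction_on_max with
  | empty => simpa [L] using hM
  | insert a S ha ih =>
    rw [L_insert_of_forall_lt x pi ha]
    have h := ih (fun i hi => hx i (Finset.mem_insert_of_mem hi))
      (fun i hi => hpi i (Finset.mem_insert_of_mem hi))
    obtain ⟨h0, h1⟩ := hpi a (Finset.mem_insert_self a S)
    have hxa := hx a (Finset.mem_insert_self a S)
    nlinarith [mul_le_mul_of_nonneg_left h (sub_nonneg.2 h1), mul_le_mul_of_nonneg_left hxa h0]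

theorem subset_or_exists_eq_insert {a : ℕ} {A S : Finset ℕ} (h : S ⊆ insert a A) :
    S ⊆ A ∨ ∃ S' ⊆ A, S = insert a S' := by
  by_cases ha : a ∈ S
  · exact .inr ⟨S.erase a, Finset.subset_insert_iff.1 h, (Finset.insert_erase ha).symm⟩
  · exact .inl ((Finset.subset_insert_iff_of_notMem ha).1 h)

theorem L_mono {x pi : ℕ → ℝ} {T : Finset ℕ} (hx : ∀ i ∈ T, 0 ≤ x i)
    (hmono : MonotoneOn x T) (hpi : ∀ i ∈ T, 0 ≤ pi i ∧ pi i ≤ 1) {S : Finset ℕ} (hST : S ⊆ T) :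
    L x pi S ≤ L x pi T := by
  induction T using Finset.induction_on_max generalizing S with
  | empty => rw [Finset.subset_empty.1 hST]
  | insert a T ha ih =>
    have hsub : T ⊆ insert a T := Finset.subset_insert a T
    have haT := Finset.mem_insert_self a T
    have ih' : ∀ S' ⊆ T, L x pi S' ≤ L x pi T := fun S' hS' =>
      ih (fun i hi => hx i (hsub hi)) (hmono.mono (Finset.coe_subset.2 hsub))
        (fun i hi => hpi i (hsub hi)) hS'
    obtain ⟨h0, h1⟩ := hpi a haT
    rw [L_insert_of_forall_lt x pi ha]
    rcases subset_or_exists_eq_insert hST with hS | ⟨S', hS, rfl⟩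
    · have hle : L x pi S ≤ 2 * x a := L_le_of_forall_le (hx a haT)
        (fun i hi => hmono (hsub (hS hi)) haT (ha i (hS hi)).le)
        (fun i hi => hpi i (hsub (hS hi)))
      nlinarith [mul_le_mul_of_nonneg_left (ih' S hS) (sub_nonneg.2 h1),
        mul_le_mul_of_nonneg_left hle h0]
    · rw [L_insert_of_forall_lt x pi fun i hi => ha i (hS hi)]
      linarith [mul_le_mul_of_nonneg_left (ih' S' hS) (sub_nonneg.2 h1)]

theorem L_union_add_L_inter_le {x pi : ℕ → ℝ} {A : Finset ℕ} (hx : ∀ i ∈ A, 0 ≤ x i)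
    (hmono : MonotoneOn x A) (hpi : ∀ i ∈ A, 0 ≤ pi i ∧ pi i ≤ 1) {S T : Finset ℕ}
    (hS : S ⊆ A) (hT : T ⊆ A) :
    L x pi (S ∪ T) + L x pi (S ∩ T) ≤ L x pi S + L x pi T := by
  induction A using Finset.induction_on_max generalizing S T with
  | empty => simp [Finset.subset_empty.1 hS, Finset.subset_empty.1 hT]
  | insert a A ha ih =>
    have hsub : A ⊆ insert a A := Finset.subset_insert a A
    obtain ⟨h0, h1⟩ := hpi a (Finset.mem_insert_self a A)
    have hnot : ∀ {U : Finset ℕ}, U ⊆ A → a ∉ U := fun hU h => lt_irrefl _ (ha a (hU h))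
    have hins : ∀ {U : Finset ℕ}, U ⊆ A →
        L x pi (insert a U) = 2 * x a * pi a + (1 - pi a) * L x pi U := fun hU =>
      L_insert_of_forall_lt x pi fun i hi => ha i (hU hi)
    have ih' : ∀ {U V : Finset ℕ}, U ⊆ A → V ⊆ A →
        L x pi (U ∪ V) + L x pi (U ∩ V) ≤ L x pi U + L x pi V := fun hU hV =>
      ih (fun i hi => hx i (hsub hi)) (hmono.mono (Finset.coe_subset.2 hsub))
        (fun i hi => hpi i (hsub hi)) hU hV
    have hone : ∀ {U V : Finset ℕ}, U ⊆ A → V ⊆ A →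
        L x pi (insert a U ∪ V) + L x pi (insert a U ∩ V) ≤
          L x pi (insert a U) + L x pi V := by
      intro U V hU hV
      rw [Finset.insert_union, Finset.insert_inter_of_notMem (hnot hV),
        hins (Finset.union_subset hU hV), hins hU]
      have hle : L x pi (U ∩ V) ≤ L x pi V := L_mono (fun i hi => hx i (hsub (hV hi)))
        (hmono.mono (Finset.coe_subset.2 (hV.trans hsub)))
        (fun i hi => hpi i (hsub (hV hi))) Finset.inter_subset_right
      nlinarith [mul_le_mul_of_nonneg_left (ih' hU hV) (sub_nonneg.2 h1),
        mul_le_mul_of_nonneg_left hle h0]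
    rcases subset_or_exists_eq_insert hS with hSA | ⟨S', hSA, rfl⟩ <;>
      rcases subset_or_exists_eq_insert hT with hTA | ⟨T', hTA, rfl⟩
    · exact ih' hSA hTA
    · rw [Finset.union_comm, Finset.inter_comm, add_comm (L x pi S)]
      exact hone hTA hSA
    · exact hone hSA hTA
    · rw [← Finset.insert_union_distrib, ← Finset.insert_inter_distrib,
        hins (Finset.union_subset hSA hTA), hins (Finset.inter_subset_left.trans hSA),
        hins hSA, hins hTA]
      linarith [mul_le_mul_of_nonneg_left (ih' hSA hTA) (sub_nonneg.2 h1)]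

theorem G_le_PPTP {n : ℕ} (x pi p : ℕ → ℝ) (c : ℝ) {S : Finset ℕ} (hS : S ⊆ Finset.Icc 1 n) :
    G x pi p S c ≤ PPTP n x pi p c :=
  Finset.le_sup' (fun S => G x pi p S c) (Finset.mem_powerset.2 hS)

theorem stmt8 (n : ℕ) (x p pi : ℕ → ℝ)
    (hx : ∀ i ∈ Finset.Icc 1 n, 0 < x i)
    (hxmono : ∀ i, 1 ≤ i → i + 1 ≤ n → x i ≤ x (i + 1))
    (hp : ∀ i ∈ Finset.Icc 1 n, 0 < p i)
    (hpi : ∀ i ∈ Finset.Icc 1 n, 0 < pi i ∧ pi i ≤ 1)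
    (S₁ S₂ : Finset ℕ) (hS₁ : S₁ ⊆ Finset.Icc 1 n) (hS₂ : S₂ ⊆ Finset.Icc 1 n)
    (c : ℝ) (hc : 0 ≤ c)
    (hopt₁ : G x pi p S₁ c = PPTP n x pi p c) (hopt₂ : G x pi p S₂ c = PPTP n x pi p c) :
    G x pi p (S₁ ∪ S₂) c = PPTP n x pi p c ∧ G x pi p (S₁ ∩ S₂) c = PPTP n x pi p c := by
  have hmono : MonotoneOn x (Finset.Icc 1 n : Finset ℕ) := by
    intro i hi j hj hij
    rw [Finset.mem_coe, Finset.mem_Icc] at hi hj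
    induction j, hij using Nat.le_induction with
    | base => exact le_rfl
    | succ j hij ih => exact (ih ⟨hi.1.trans hij, by omega⟩).trans (hxmono j (by omega) hj.2)
  have hL := L_union_add_L_inter_le (fun i hi => (hx i hi).le) hmono
    (fun i hi => ⟨(hpi i hi).1.le, (hpi i hi).2⟩) hS₁ hS₂
  have hR : R pi p (S₁ ∪ S₂) + R pi p (S₁ ∩ S₂) = R pi p S₁ + R pi p S₂ :=
    Finset.sum_union_inter
  have hU := G_le_PPTP x pi p c (Finset.union_subset hS₁ hS₂)
  have hI := G_le_PPTP x pi p c (Finset.inter_subset_left.trans hS₁ : S₁ ∩ S₂ ⊆ _)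
  have hcL := mul_le_mul_of_nonneg_left hL hc
  unfold G at *
  constructor <;> linarith
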